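/- Let Γ = (V, E) be a Cayley tree of order 2, with fixed root x₀ and balls V_n. There exists β₀ > 0 such that for all β ≥ β₀ and all n ≥ 1, the finite-volume Gibbs measures of the ferromagnetic Ising model with all-plus and all-minus boundary conditions satisfy μ_{n,β}^+ ({σ : σ(x₀) = −1}) < 1/2 and μ_{n,β}^− ({σ : σ(x₀) = −1}) > 1/2; in particular, for all β ≥ β₀ and all n, the distribution of the spin at the root under μ_{n,β}^+ differs from its distribution under μ_{n,β}^−. -/

import Mathlib

/-- A Cayley tree of order 2: a connected acyclic simple graph every vertex of which has
degree 3. -/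
def IsCayleyTree2 {V : Type*} (Γ : SimpleGraph V) : Prop :=
  Γ.Connected ∧ Γ.IsAcyclic ∧ ∀ v : V, (Γ.neighborSet v).ncard = 3

/-- The outer boundary `∂A` of a set of vertices `A`. -/
def outerBoundary {V : Type*} (Γ : SimpleGraph V) (A : Set V) : Set V :=
  {x | x ∉ A ∧ ∃ y ∈ A, Γ.Adj x y}

/-- `C` is a connected component of the subgraph induced on `S`. -/
def IsCompOf {V : Type*} (Γ : SimpleGraph V) (S C : Set V) : Prop :=
  C ⊆ S ∧ C.Nonempty ∧ (Γ.induce C).Connected ∧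
    ∀ x ∈ S, ∀ y ∈ C, Γ.Adj x y → x ∈ C

/-- The ball `V_n = {x : d(x₀, x) ≤ n}` around the root `x₀`. -/
def ballSet {V : Type*} (Γ : SimpleGraph V) (x₀ : V) (n : ℕ) : Set V :=
  {x | Γ.dist x₀ x ≤ n}

/-- The set of edges of `Γ` having at least one endpoint in `A`. -/
def meetingEdges {V : Type*} (Γ : SimpleGraph V) (A : Set V) : Set (Sym2 V) :=
  {e | e ∈ Γ.edgeSet ∧ ∃ x ∈ A, x ∈ e}

/-- The ferromagnetic Ising Hamiltonian (`J₁ = −1`, `J₂ = 0`) in volume `V_n`: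
`H_n(σ) = −∑ σ(x)σ(y)`, the sum over all edges meeting `V_n`. -/
noncomputable def isingH {V : Type*} (Γ : SimpleGraph V) (x₀ : V) (n : ℕ) (σ : V → ℤ) : ℤ :=
  -∑ᶠ e ∈ meetingEdges Γ (ballSet Γ x₀ n),
      Sym2.lift ⟨fun x y => σ x * σ y, fun x y => mul_comm (σ x) (σ y)⟩ e

/-- `Ω_n^ε`: spin configurations equal to `ε` outside `V_n`. -/
def OmegaBC {V : Type*} (Γ : SimpleGraph V) (x₀ : V) (n : ℕ) (ε : ℤ) : Set (V → ℤ) :=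
  {σ | (∀ x, σ x = 1 ∨ σ x = -1) ∧ ∀ x ∉ ballSet Γ x₀ n, σ x = ε}

/-- The finite-volume Gibbs measure `μ_{n,β}^ε` of the event `A`. -/
noncomputable def gibbs {V : Type*} (Γ : SimpleGraph V) (x₀ : V) (n : ℕ) (β : ℝ) (ε : ℤ)
    (A : Set (V → ℤ)) : ℝ :=
  (∑ᶠ σ ∈ A ∩ OmegaBC Γ x₀ n ε, Real.exp (-β * (isingH Γ x₀ n σ : ℝ))) /
    ∑ᶠ σ ∈ OmegaBC Γ x₀ n ε, Real.exp (-β * (isingH Γ x₀ n σ : ℝ))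

open Finset in
/-- Griffiths' first inequality for a product of factors `c + s * χ_e`, in the powerset model. -/
lemma sum_powerset_char_nonneg {V ι : Type*} [DecidableEq ι] (B : Finset V) (E : Finset ι)
    (ψ : ι → V → ℝ) (hψ : ∀ e x, |ψ e x| ≤ 1) {c s : ℝ} (hc : 0 < c) (hs : 0 < s)
    (χ : V → ℝ) (hχ : ∀ x, |χ x| ≤ 1) :
    0 ≤ ∑ T ∈ B.powerset, (∏ x ∈ T, χ x) * ∏ e ∈ E, (c + s * ∏ x ∈ T, ψ e x) := by
  induction E using Finset.induction_on generalizing χ with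
  | empty =>
    simp only [prod_empty, mul_one]
    rw [← prod_one_add]
    exact prod_nonneg fun x _ => by linarith [(abs_le.1 (hχ x)).1]
  | insert e E he ih =>
    have h₁ := ih χ hχ
    have h₂ := ih (fun x => χ x * ψ e x) fun x => by
      rw [abs_mul]; exact mul_le_one₀ (hχ x) (abs_nonneg _) (hψ e x)
    have := add_nonneg (mul_nonneg hc.le h₁) (mul_nonneg hs.le h₂)
    rw [mul_sum, mul_sum, ← sum_add_distrib] at this
    refine this.trans_eq (sum_congr rfl fun T _ => ?_)
    rw [prod_insert he, prod_mul_distrib]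
    ring

open Finset in
/-- Strict form of Griffiths' first inequality: it suffices that some product of the interaction
characters cancels `χ`. -/
lemma sum_powerset_char_pos {V ι : Type*} [DecidableEq ι] (B : Finset V) (E : Finset ι)
    (ψ : ι → V → ℝ) (hψ : ∀ e x, |ψ e x| ≤ 1) {c s : ℝ} (hc : 0 < c) (hs : 0 < s)
    (χ : V → ℝ) (hχ : ∀ x, |χ x| ≤ 1) (P : Finset ι) (hP : P ⊆ E)
    (h : ∀ x ∈ B, χ x * ∏ e ∈ P, ψ e x = 1) :
    0 < ∑ T ∈ B.powerset, (∏ x ∈ T, χ x) * ∏ e ∈ E, (c + s * ∏ x ∈ T, ψ e x) := by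
  induction E using Finset.induction_on generalizing χ P with
  | empty =>
    obtain rfl := subset_empty.1 hP
    simp only [prod_empty, mul_one] at h ⊢
    rw [← prod_one_add]
    exact prod_pos fun x hx => by rw [h x hx]; norm_num
  | insert e E he ih =>
    have hχ' : ∀ x, |χ x * ψ e x| ≤ 1 := fun x => by
      rw [abs_mul]; exact mul_le_one₀ (hχ x) (abs_nonneg _) (hψ e x)
    have key : 0 < c * (∑ T ∈ B.powerset, (∏ x ∈ T, χ x) * ∏ e ∈ E, (c + s * ∏ x ∈ T, ψ e x)) +
        s * (∑ T ∈ B.powerset, (∏ x ∈ T, χ x * ψ e x) *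
          ∏ e ∈ E, (c + s * ∏ x ∈ T, ψ e x)) := by
      by_cases heP : e ∈ P
      · refine add_pos_of_nonneg_of_pos
          (mul_nonneg hc.le (sum_powerset_char_nonneg B E ψ hψ hc hs χ hχ))
          (mul_pos hs (ih _ hχ' (P.erase e) (subset_insert_iff.1 hP) fun x hx => ?_))
        rw [mul_assoc, mul_prod_erase P (fun e => ψ e x) heP, h x hx]
      · exact add_pos_of_pos_of_nonneg
          (mul_pos hc (ih χ hχ P ((subset_insert_iff_of_notMem heP).1 hP) h))
          (mul_nonneg hs.le (sum_powerset_char_nonneg B E ψ hψ hc hs _ hχ'))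
    rw [mul_sum, mul_sum, ← sum_add_distrib] at key
    refine key.trans_eq (sum_congr rfl fun T _ => ?_)
    rw [prod_insert he, prod_mul_distrib]
    ring

open Classical in
/-- The character of the spin at `y`: flipping the spin at `x` multiplies it by `siteChar y x`. -/
noncomputable def siteChar {V : Type*} (y x : V) : ℝ := if x = y then -1 else 1

/-- The character of the product of the two spins on an edge. -/
noncomputable def edgeChar {V : Type*} (e : Sym2 V) (x : V) : ℝ :=
  Sym2.lift ⟨fun y z => siteChar y x * siteChar z x, fun _ _ => mul_comm _ _⟩ e

lemma abs_siteChar {V : Type*} (y x : V) : |siteChar y x| = 1 := by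
  unfold siteChar; split_ifs <;> simp

lemma siteChar_mul_self {V : Type*} (y x : V) : siteChar y x * siteChar y x = 1 := by
  unfold siteChar; split_ifs <;> simp

lemma abs_edgeChar {V : Type*} (e : Sym2 V) (x : V) : |edgeChar e x| = 1 := by
  induction e with
  | h y z => simp [edgeChar, abs_mul, abs_siteChar]

open Classical in
/-- The configuration equal to `-ε` on `T` and to `ε` elsewhere. -/
noncomputable def spin {V : Type*} (ε : ℤ) (T : Finset V) (x : V) : ℤ := if x ∈ T then -ε else ε

lemma prod_siteChar {V : Type*} (T : Finset V) (y : V) :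
    ∏ x ∈ T, siteChar y x = (spin 1 T y : ℝ) := by
  classical
  simp only [siteChar, spin, Finset.prod_ite_eq']
  split_ifs <;> simp

lemma spin_injective {V : Type*} {ε : ℤ} (hε : ε ≠ 0) :
    Function.Injective (spin ε : Finset V → V → ℤ) := by
  classical
  intro S T h
  ext x
  have := congrFun h x
  simp only [spin] at this
  split_ifs at this <;> first | tauto | omega

lemma inter_omegaBC_eq_image {V : Type*} (Γ : SimpleGraph V) (x₀ : V) (n : ℕ) {ε : ℤ}
    (hε : ε = 1 ∨ ε = -1) (B : Finset V) (hB : (B : Set V) = ballSet Γ x₀ n)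
    (A : Set (V → ℤ)) [DecidablePred fun T => spin ε T ∈ A] :
    A ∩ OmegaBC Γ x₀ n ε = spin ε '' ↑(B.powerset.filter fun T => spin ε T ∈ A) := by
  classical
  ext σ
  simp only [OmegaBC, ← hB, Set.mem_inter_iff, Set.mem_ofPred_eq, Set.mem_image, Finset.mem_coe,
    Finset.mem_filter, Finset.mem_powerset]
  constructor
  · rintro ⟨hA, h₁, h₂⟩
    have hσ : spin ε (B.filter fun x => σ x = -ε) = σ := by
      funext x
      simp only [spin, Finset.mem_filter]
      split_ifs with hx
      · exact hx.2.symm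
      · by_cases hxB : x ∈ B
        · have := h₁ x
          have : σ x ≠ -ε := fun h => hx ⟨hxB, h⟩
          omega
        · exact (h₂ x hxB).symm
    exact ⟨_, ⟨Finset.filter_subset _ _, hσ.symm ▸ hA⟩, hσ⟩
  · rintro ⟨T, ⟨hT, hA⟩, rfl⟩
    refine ⟨hA, fun x => ?_, fun x hx => if_neg fun h => hx (hT h)⟩
    simp only [spin]
    split_ifs <;> omega

lemma isingH_spin {V : Type*} (Γ : SimpleGraph V) (x₀ : V) (n : ℕ) {ε : ℤ}
    (hε : ε = 1 ∨ ε = -1) (T : Finset V) :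
    isingH Γ x₀ n (spin ε T) = isingH Γ x₀ n (spin 1 T) := by
  unfold isingH
  congr 2
  funext e
  congr 1
  funext _
  induction e with
  | h y z =>
    simp only [Sym2.lift_mk, spin]
    rcases hε with rfl | rfl <;> split_ifs <;> rfl

open Classical in
lemma gibbs_eq_sum_powerset {V : Type*} (Γ : SimpleGraph V) (x₀ : V) (n : ℕ) (β : ℝ) {ε : ℤ}
    (hε : ε = 1 ∨ ε = -1) (B : Finset V) (hB : (B : Set V) = ballSet Γ x₀ n)
    (A : Set (V → ℤ)) :
    gibbs Γ x₀ n β ε A =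
      (∑ T ∈ B.powerset with spin ε T ∈ A, Real.exp (-β * (isingH Γ x₀ n (spin 1 T) : ℝ))) /
        ∑ T ∈ B.powerset, Real.exp (-β * (isingH Γ x₀ n (spin 1 T) : ℝ)) := by
  have hinj := spin_injective (V := V) (ε := ε) (by omega)
  have key : ∀ A : Set (V → ℤ),
      ∑ᶠ σ ∈ A ∩ OmegaBC Γ x₀ n ε, Real.exp (-β * (isingH Γ x₀ n σ : ℝ)) =
        ∑ T ∈ B.powerset with spin ε T ∈ A,
          Real.exp (-β * (isingH Γ x₀ n (spin 1 T) : ℝ)) := fun A => by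
    rw [inter_omegaBC_eq_image Γ x₀ n hε B hB A, finsum_mem_image hinj.injOn,
      finsum_mem_coe_finset]
    simp only [isingH_spin Γ x₀ n hε]
  have h := key Set.univ
  simp only [Set.univ_inter, Set.mem_univ, Finset.filter_true] at h
  rw [gibbs, key, h]

lemma exp_isingH_spin {V : Type*} (Γ : SimpleGraph V) (x₀ : V) (n : ℕ) (β : ℝ)
    (E : Finset (Sym2 V)) (hE : (E : Set (Sym2 V)) = meetingEdges Γ (ballSet Γ x₀ n))
    (T : Finset V) :
    Real.exp (-β * (isingH Γ x₀ n (spin 1 T) : ℝ)) =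
      ∏ e ∈ E, (Real.cosh β + Real.sinh β * ∏ x ∈ T, edgeChar e x) := by
  rw [isingH, ← hE, finsum_mem_coe_finset]
  push_cast
  rw [neg_mul_neg, Finset.mul_sum, Real.exp_sum]
  refine Finset.prod_congr rfl fun e _ => ?_
  induction e with
  | h y z =>
    simp only [edgeChar, Sym2.lift_mk, Finset.prod_mul_distrib, prod_siteChar]
    have h : ∀ y, (spin 1 T y : ℝ) = 1 ∨ (spin 1 T y : ℝ) = -1 := fun y => by
      unfold spin; split_ifs <;> simp
    push_cast
    rcases h y with hy | hy <;> rcases h z with hz | hz <;> rw [hy, hz] <;>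
      simp [← sub_eq_add_neg]

lemma exists_adj_dist_eq {V : Type*} {Γ : SimpleGraph V} (hΓ : Γ.Connected) {x₀ x : V} {k : ℕ}
    (hx : Γ.dist x₀ x = k + 1) : ∃ y, Γ.Adj y x ∧ Γ.dist x₀ y = k := by
  obtain ⟨p, hp⟩ := hΓ.exists_walk_length_eq_dist x x₀
  rw [SimpleGraph.dist_comm, hx] at hp
  cases p with
  | nil => simp at hp
  | @cons _ y _ h q =>
    refine ⟨y, h.symm, ?_⟩
    have h₁ : Γ.dist y x₀ ≤ q.length := SimpleGraph.dist_le q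
    have h₂ : Γ.dist x₀ x ≤ Γ.dist x₀ y + Γ.dist y x := hΓ.dist_triangle
    have h₃ : Γ.dist y x = 1 := SimpleGraph.dist_eq_one_iff_adj.2 h.symm
    rw [SimpleGraph.dist_comm] at h₁
    simp only [SimpleGraph.Walk.length_cons] at hp
    omega

lemma exists_dist_eq_of_le {V : Type*} {Γ : SimpleGraph V} (hΓ : Γ.Connected) {x₀ x : V} {k : ℕ}
    (hx : k ≤ Γ.dist x₀ x) : ∃ y, Γ.dist x₀ y = k := by
  induction hm : Γ.dist x₀ x - k generalizing x with
  | zero => exact ⟨x, by omega⟩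
  | succ m ih =>
    obtain ⟨y, -, hy⟩ := exists_adj_dist_eq hΓ (x₀ := x₀) (x := x) (k := k + m) (by omega)
    exact ih (x := y) (by omega) (by omega)

/-- The edges of a geodesic from `x₀` to `y`, as characters, multiply to the product of the
characters of its end points. -/
lemma exists_prod_edgeChar {V : Type*} {Γ : SimpleGraph V} (hΓ : Γ.Connected) {x₀ : V} {k : ℕ}
    {y : V} (hy : Γ.dist x₀ y = k) :
    ∃ P : Finset (Sym2 V), (∀ e ∈ P, e ∈ Γ.edgeSet ∧ (∀ x ∈ e, Γ.dist x₀ x ≤ k) ∧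
        ∃ x ∈ e, Γ.dist x₀ x < k) ∧
      ∀ x, ∏ e ∈ P, edgeChar e x = siteChar x₀ x * siteChar y x := by
  classical
  induction k generalizing y with
  | zero =>
    obtain rfl := hΓ.dist_eq_zero_iff.1 hy
    exact ⟨∅, by simp, fun x => by simp [siteChar_mul_self]⟩
  | succ k ih =>
    obtain ⟨z, hzy, hz⟩ := exists_adj_dist_eq hΓ hy
    obtain ⟨P, hP, hprod⟩ := ih hz
    refine ⟨insert s(z, y) P, fun e he => ?_, fun x => ?_⟩
    · rcases Finset.mem_insert.1 he with rfl | he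
      · refine ⟨hzy, fun x hx => ?_, z, by simp, by omega⟩
        rcases Sym2.mem_iff.1 hx with rfl | rfl <;> omega
      · obtain ⟨h₁, h₂, x, hx, h₃⟩ := hP e he
        exact ⟨h₁, fun x hx => (h₂ x hx).trans k.le_succ, x, hx, by omega⟩
    · have : s(z, y) ∉ P := fun h => by
        have := (hP _ h).2.1 y (by simp)
        omega
      rw [Finset.prod_insert this, hprod, edgeChar, Sym2.lift_mk]
      linear_combination siteChar y x * siteChar x₀ x * siteChar_mul_self z x

lemma finite_neighborSet {V : Type*} {Γ : SimpleGraph V} (hΓ : IsCayleyTree2 Γ) (v : V) :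
    (Γ.neighborSet v).Finite :=
  Set.finite_of_ncard_ne_zero (by rw [hΓ.2.2 v]; norm_num)

lemma finite_ballSet {V : Type*} {Γ : SimpleGraph V} (hΓ : IsCayleyTree2 Γ) (x₀ : V) (n : ℕ) :
    (ballSet Γ x₀ n).Finite := by
  induction n with
  | zero =>
    refine (Set.finite_singleton x₀).subset fun x hx => ?_
    exact (hΓ.1.dist_eq_zero_iff.1 (Nat.le_zero.1 hx)).symm
  | succ n ih =>
    refine (ih.union (ih.biUnion fun y _ => finite_neighborSet hΓ y)).subset fun x hx => ?_
    rcases Nat.lt_or_ge n (Γ.dist x₀ x) with h | h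
    · obtain ⟨y, hyx, hy⟩ := exists_adj_dist_eq hΓ.1 (le_antisymm hx h)
      exact Or.inr (Set.mem_biUnion (x := y) hy.le hyx)
    · exact Or.inl h

lemma finite_meetingEdges {V : Type*} {Γ : SimpleGraph V} (hΓ : IsCayleyTree2 Γ) {A : Set V}
    (hA : A.Finite) : (meetingEdges Γ A).Finite := by
  refine (hA.biUnion fun x _ => (finite_neighborSet hΓ x).image fun y => s(x, y)).subset ?_
  rintro e ⟨he, x, hx, hxe⟩
  obtain ⟨y, rfl⟩ := hxe
  exact Set.mem_biUnion hx ⟨y, he, rfl⟩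

lemma infinite_of_isCayleyTree2 {V : Type*} {Γ : SimpleGraph V} (hΓ : IsCayleyTree2 Γ) :
    Infinite V := by
  classical
  by_contra hV
  rw [not_infinite_iff_finite] at hV
  have := Fintype.ofFinite V
  have h₁ := SimpleGraph.IsTree.card_edgeFinset (G := Γ) ⟨hΓ.1, hΓ.2.1⟩
  have h₂ := Γ.sum_degrees_eq_twice_card_edges
  have h₃ : ∀ v, Γ.degree v = 3 := fun v => by
    rw [← hΓ.2.2 v, Set.ncard_eq_toFinset_card', Set.toFinset_card,
      SimpleGraph.card_neighborSet_eq_degree]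
  simp only [h₃, Finset.sum_const, Finset.card_univ, smul_eq_mul] at h₂
  omega

lemma sum_spin_mul_exp_pos {V : Type*} {Γ : SimpleGraph V} (hΓ : IsCayleyTree2 Γ) (x₀ : V) (n : ℕ)
    {β : ℝ} (hβ : 0 < β) (B : Finset V) (hB : (B : Set V) = ballSet Γ x₀ n) :
    0 < ∑ T ∈ B.powerset,
      (spin 1 T x₀ : ℝ) * Real.exp (-β * (isingH Γ x₀ n (spin 1 T) : ℝ)) := by
  classical
  obtain ⟨E, hE⟩ := (finite_meetingEdges hΓ (finite_ballSet hΓ x₀ n)).exists_finset_coe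
  simp only [← prod_siteChar, exp_isingH_spin Γ x₀ n β E hE]
  have := infinite_of_isCayleyTree2 hΓ
  obtain ⟨y', hy'⟩ := (finite_ballSet hΓ x₀ n).exists_notMem
  obtain ⟨y, hy⟩ := exists_dist_eq_of_le hΓ.1 (Nat.succ_le_of_lt (not_le.1 hy'))
  obtain ⟨P, hP, hprod⟩ := exists_prod_edgeChar hΓ.1 hy
  refine sum_powerset_char_pos B E edgeChar (fun e x => (abs_edgeChar e x).le)
    (Real.cosh_pos β) (Real.sinh_pos_iff.2 hβ) _ (fun x => (abs_siteChar x₀ x).le) P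
    (fun e he => ?_) fun x hx => ?_
  · obtain ⟨h₁, -, x, hx, h₂⟩ := hP e he
    rw [← Finset.mem_coe, hE]
    exact ⟨h₁, x, Nat.le_of_lt_succ h₂, hx⟩
  · have hxy : siteChar y x = 1 := by
      refine if_neg ?_
      rintro rfl
      have : Γ.dist x₀ x ≤ n := by rwa [← Finset.mem_coe, hB] at hx
      omega
    rw [hprod, hxy, mul_one, siteChar_mul_self]

/-- For all sufficiently large `β`, uniformly in the volume, the probability that the root
has spin `−1` is `< 1/2` under the all-plus boundary condition and `> 1/2` under the
all-minus boundary condition; in particular the two root-spin distributions differ. -/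
theorem two_gibbs_measures {V : Type*} (Γ : SimpleGraph V) (hΓ : IsCayleyTree2 Γ)
    (x₀ : V) :
    ∃ β₀ : ℝ, 0 < β₀ ∧ ∀ β ≥ β₀, ∀ n : ℕ, 1 ≤ n →
      gibbs Γ x₀ n β 1 {σ | σ x₀ = -1} < 1 / 2 ∧
      1 / 2 < gibbs Γ x₀ n β (-1) {σ | σ x₀ = -1} ∧
      gibbs Γ x₀ n β 1 {σ | σ x₀ = -1} ≠ gibbs Γ x₀ n β (-1) {σ | σ x₀ = -1} := by
  classical
  refine ⟨1, one_pos, fun β hβ n _ => ?_⟩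
  obtain ⟨B, hB⟩ := (finite_ballSet hΓ x₀ n).exists_finset_coe
  have hpos := sum_spin_mul_exp_pos hΓ x₀ n (one_pos.trans_le hβ) B hB
  have hp : gibbs Γ x₀ n β 1 {σ | σ x₀ = -1} =
      (∑ T ∈ B.powerset with x₀ ∈ T, Real.exp (-β * (isingH Γ x₀ n (spin 1 T) : ℝ))) /
        ∑ T ∈ B.powerset, Real.exp (-β * (isingH Γ x₀ n (spin 1 T) : ℝ)) := by
    rw [gibbs_eq_sum_powerset Γ x₀ n β (Or.inl rfl) B hB]
    simp [spin]
  have hm : gibbs Γ x₀ n β (-1) {σ | σ x₀ = -1} =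
      (∑ T ∈ B.powerset with x₀ ∉ T, Real.exp (-β * (isingH Γ x₀ n (spin 1 T) : ℝ))) /
        ∑ T ∈ B.powerset, Real.exp (-β * (isingH Γ x₀ n (spin 1 T) : ℝ)) := by
    rw [gibbs_eq_sum_powerset Γ x₀ n β (Or.inr rfl) B hB]
    simp [spin]
  set w : Finset V → ℝ := fun T => Real.exp (-β * (isingH Γ x₀ n (spin 1 T) : ℝ))
  have hZ : 0 < ∑ T ∈ B.powerset, w T :=
    Finset.sum_pos (fun T _ => Real.exp_pos _) (Finset.powerset_nonempty B)
  have hsplit := Finset.sum_filter_add_sum_filter_not B.powerset (fun T => x₀ ∈ T) w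
  have hdiff : ∑ T ∈ B.powerset, (spin 1 T x₀ : ℝ) * w T =
      ∑ T ∈ B.powerset with x₀ ∉ T, w T - ∑ T ∈ B.powerset with x₀ ∈ T, w T := by
    rw [Finset.sum_filter, Finset.sum_filter, ← Finset.sum_sub_distrib]
    refine Finset.sum_congr rfl fun T _ => ?_
    by_cases h : x₀ ∈ T <;> simp [spin, h]
  have hplus : gibbs Γ x₀ n β 1 {σ | σ x₀ = -1} < 1 / 2 := by
    rw [hp, div_lt_div_iff₀ hZ two_pos]
    linarith
  have hminus : 1 / 2 < gibbs Γ x₀ n β (-1) {σ | σ x₀ = -1} := by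
    rw [hm, div_lt_div_iff₀ two_pos hZ]
    linarith
  exact ⟨hplus, hminus, (hplus.trans hminus).ne⟩
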